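/- p₃(B₂(g)) = I_A ⊗ (k∧k'), and the corresponding subspace P⁻¹(I_A ⊗ (k∧k')) of Λ²(g) is contained in B₂(g). Here k' := [k,k] and k∧k' := span{ x∧y : x ∈ k, y ∈ k' } ⊆ Λ²(k). -/

import Mathlib

set_option linter.unusedSectionVars false
set_option synthInstance.maxHeartbeats 1000000
set_option maxHeartbeats 1000000
open scoped TensorProduct

namespace CurrentPaper

variable (K : Type*) [Field K] [CharZero K]

section Wedge

variable (V : Type*) [AddCommGroup V] [Module K V]

/-- `x ∧ y = (1/2)(x ⊗ y - y ⊗ x)` inside `V ⊗ V`. -/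
noncomputable def wedge (x y : V) : V ⊗[K] V := (2 : K)⁻¹ • (x ⊗ₜ[K] y - y ⊗ₜ[K] x)

/-- `x ∨ y = (1/2)(x ⊗ y + y ⊗ x)` inside `V ⊗ V`. -/
noncomputable def vee (x y : V) : V ⊗[K] V := (2 : K)⁻¹ • (x ⊗ₜ[K] y + y ⊗ₜ[K] x)

/-- `Λ²(V)` realized as the subspace of skew-symmetric tensors of `V ⊗ V`. -/
def lambda2 : Submodule K (V ⊗[K] V) := Submodule.span K {t | ∃ x y : V, t = wedge K V x y}

/-- `S²(V)` realized as the subspace of symmetric tensors of `V ⊗ V`. -/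
def sym2 : Submodule K (V ⊗[K] V) := Submodule.span K {t | ∃ x y : V, t = vee K V x y}

variable {V}

lemma wedge_mem (x y : V) : wedge K V x y ∈ lambda2 K V := Submodule.subset_span ⟨x, y, rfl⟩

lemma vee_mem (x y : V) : vee K V x y ∈ sym2 K V := Submodule.subset_span ⟨x, y, rfl⟩

end Wedge

section LieRelaxed

variable (L : Type*) [LieRing L] [Module K L]

/-- `∂(u ∧ v ∧ w) = ⁅u,v⁆ ∧ w + ⁅v,w⁆ ∧ u + ⁅w,u⁆ ∧ v`. -/
noncomputable def dd (u v w : L) : L ⊗[K] L :=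
  wedge K L ⁅u, v⁆ w + wedge K L ⁅v, w⁆ u + wedge K L ⁅w, u⁆ v

/-- `B₂(L)`, the space of 2-boundaries, i.e. the image of `∂ : Λ³(L) → Λ²(L)`. -/
def B2 : Submodule K (L ⊗[K] L) := Submodule.span K {t | ∃ u v w : L, t = dd K L u v w}

variable {L}

lemma dd_mem_lambda2 (u v w : L) : dd K L u v w ∈ lambda2 K L :=
  add_mem (add_mem (wedge_mem K _ _) (wedge_mem K _ _)) (wedge_mem K _ _)

lemma dd_mem_B2 (u v w : L) : dd K L u v w ∈ B2 K L := Submodule.subset_span ⟨u, v, w, rfl⟩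

end LieRelaxed

section Lie

variable (L : Type*) [LieRing L] [LieAlgebra K L]

/-- The bracket `b : L ⊗ L → L`, `u ⊗ v ↦ ⁅u,v⁆`, as a linear map. -/
noncomputable def bracketHom : L ⊗[K] L →ₗ[K] L :=
  TensorProduct.lift (LinearMap.mk₂ K (fun u v => ⁅u, v⁆) add_lie smul_lie lie_add lie_smul)

/-- `Z₂(L) = Λ²(L) ∩ ker b`, the space of 2-cycles. -/
noncomputable def Z2 : Submodule K (L ⊗[K] L) := lambda2 K L ⊓ LinearMap.ker (bracketHom K L)

/-- The derived algebra `L' = [L,L]`, as a subspace of `L`. -/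
def derived : Submodule K L := Submodule.span K {m | ∃ u v : L, m = ⁅u, v⁆}

end Lie

section Alg

variable (A : Type*) [CommRing A] [Algebra K A]

/-- `I_A ⊆ S²(A)`: the kernel of the multiplication map `S²(A) → A`. -/
noncomputable def ia : Submodule K (A ⊗[K] A) := sym2 K A ⊓ LinearMap.ker (LinearMap.mul' K A)

/-- `T(A) ⊆ Λ²(A)`: the span of the elements `ab ∧ c + bc ∧ a + ca ∧ b`. -/
def TA : Submodule K (A ⊗[K] A) :=
  Submodule.span K
    {t | ∃ a b c : A, t = wedge K A (a*b) c + wedge K A (b*c) a + wedge K A (c*a) b}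

/-- `T₀(A) ⊆ Λ²(A)`: the span of the elements `ab ∧ c + bc ∧ a + ca ∧ b - abc ∧ 1`. -/
def T0A : Submodule K (A ⊗[K] A) :=
  Submodule.span K
    {t | ∃ a b c : A,
      t = wedge K A (a*b) c + wedge K A (b*c) a + wedge K A (c*a) b - wedge K A (a*b*c) 1}

variable {A}

lemma TA_el_mem_lambda2 (a b c : A) :
    wedge K A (a*b) c + wedge K A (b*c) a + wedge K A (c*a) b ∈ lambda2 K A :=
  add_mem (add_mem (wedge_mem K _ _) (wedge_mem K _ _)) (wedge_mem K _ _)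

lemma T0A_el_mem_lambda2 (a b c : A) :
    wedge K A (a*b) c + wedge K A (b*c) a + wedge K A (c*a) b - wedge K A (a*b*c) 1 ∈
      lambda2 K A :=
  sub_mem (TA_el_mem_lambda2 K a b c) (wedge_mem K _ _)

lemma ia_el_mem (a b : A) : vee K A a b - vee K A (a * b) 1 ∈ ia K A := by
  refine Submodule.mem_inf.mpr ⟨sub_mem (vee_mem K a b) (vee_mem K _ _), ?_⟩
  simp only [LinearMap.mem_ker, map_sub, vee, map_smul, map_add, LinearMap.mul'_apply,
    mul_one, one_mul, mul_comm b a]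
  simp

end Alg

section Current

variable (A : Type*) [CommRing A] [Algebra K A]
variable (k : Type*) [LieRing k] [LieAlgebra K k]

lemma g_smul_lie (c : K) (x y : A ⊗[K] k) : ⁅c • x, y⁆ = c • ⁅x, y⁆ := by
  rw [← algebraMap_smul A c x, ← algebraMap_smul A c ⁅x, y⁆, smul_lie]

lemma g_lie_smul (c : K) (x y : A ⊗[K] k) : ⁅x, c • y⁆ = c • ⁅x, y⁆ := by
  rw [← algebraMap_smul A c y, ← algebraMap_smul A c ⁅x, y⁆, lie_smul]

/-- The bracket of the current algebra `g = A ⊗ k`, as a `K`-linear map `g ⊗ g → g`. -/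
noncomputable def gBracket : (A ⊗[K] k) ⊗[K] (A ⊗[K] k) →ₗ[K] A ⊗[K] k :=
  TensorProduct.lift (LinearMap.mk₂ K (fun u v => ⁅u, v⁆) add_lie
    (fun c x y => g_smul_lie K A k c x y) lie_add (fun c x y => g_lie_smul K A k c x y))

/-- `Z₂(g) = Λ²(g) ∩ ker b` for the current algebra `g = A ⊗ k`. -/
noncomputable def Z2g : Submodule K ((A ⊗[K] k) ⊗[K] (A ⊗[K] k)) :=
  lambda2 K (A ⊗[K] k) ⊓ LinearMap.ker (gBracket K A k)

/-- The first summand `Λ²(A) ⊗ S²(k)` of the decomposition of `Λ²(A ⊗ k)`. -/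
abbrev M1 := (↥(lambda2 K A)) ⊗[K] (↥(sym2 K k))

/-- The second summand `A ⊗ Λ²(k)` of the decomposition of `Λ²(A ⊗ k)`. -/
abbrev M2 := A ⊗[K] (↥(lambda2 K k))

/-- The third summand `I_A ⊗ Λ²(k)` of the decomposition of `Λ²(A ⊗ k)`. -/
abbrev M3 := (↥(ia K A)) ⊗[K] (↥(lambda2 K k))

/-- The target of the isomorphism `P = (p₁,p₂,p₃)`. -/
abbrev Wspace := M1 K A k × M2 K A k × M3 K A k

variable {A k}

/-- The property characterizing the linear isomorphism
`P = (p₁,p₂,p₃) : Λ²(A ⊗ k) ≅ (Λ²(A) ⊗ S²(k)) ⊕ (A ⊗ Λ²(k)) ⊕ (I_A ⊗ Λ²(k))`: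
`p₁(ax ∧ by) = a ∧ b ⊗ x ∨ y`, `p₂(ax ∧ by) = ab ⊗ x ∧ y`,
`p₃(ax ∧ by) = (a ∨ b - ab ∨ 1) ⊗ x ∧ y`. -/
def IsDecomposition (P : ↥(lambda2 K (A ⊗[K] k)) ≃ₗ[K] Wspace K A k) : Prop :=
  ∀ (a b : A) (x y : k),
    P ⟨wedge K (A ⊗[K] k) (a ⊗ₜ x) (b ⊗ₜ y), wedge_mem K _ _⟩ =
      ((⟨wedge K A a b, wedge_mem K a b⟩ ⊗ₜ[K] ⟨vee K k x y, vee_mem K x y⟩ : M1 K A k),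
       ((a * b) ⊗ₜ[K] ⟨wedge K k x y, wedge_mem K x y⟩ : M2 K A k),
       ((⟨vee K A a b - vee K A (a * b) 1, ia_el_mem K a b⟩ ⊗ₜ[K]
          ⟨wedge K k x y, wedge_mem K x y⟩ : M3 K A k)))

end Current

end CurrentPaper

namespace CurrentPaper

variable (K : Type*) [Field K] [CharZero K]
variable (A : Type*) [CommRing A] [Algebra K A]
variable (k : Type*) [LieRing k] [LieAlgebra K k]

/-- `k ∧ k' = span{ x ∧ y : x ∈ k, y ∈ k' } ⊆ Λ²(k)`. -/
noncomputable def kWedgeDer : Submodule K (k ⊗[K] k) :=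
  Submodule.span K {t | ∃ x y : k, y ∈ derived K k ∧ t = wedge K k x y}

/-- The subspace `I_A ⊗ (k ∧ k')` of `I_A ⊗ Λ²(k)`. -/
noncomputable def sub3 : Submodule K (M3 K A k) :=
  Submodule.span K {t | ∃ (c : ↥(ia K A)) (s : ↥(lambda2 K k)),
    (s : k ⊗[K] k) ∈ kWedgeDer K k ∧ t = c ⊗ₜ[K] s}

section WedgeLemmas

variable {V : Type*} [AddCommGroup V] [Module K V]

lemma wedge_add_left (x x' y : V) : wedge K V (x + x') y = wedge K V x y + wedge K V x' y := by
  simp only [wedge, TensorProduct.add_tmul, TensorProduct.tmul_add]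
  module

lemma wedge_add_right (x y y' : V) : wedge K V x (y + y') = wedge K V x y + wedge K V x y' := by
  simp only [wedge, TensorProduct.add_tmul, TensorProduct.tmul_add]
  module

lemma wedge_smul_right (c : K) (x y : V) : wedge K V x (c • y) = c • wedge K V x y := by
  simp only [wedge, ← TensorProduct.smul_tmul', TensorProduct.tmul_smul]
  module

lemma wedge_zero_left (y : V) : wedge K V 0 y = 0 := by
  simp [wedge]

lemma wedge_zero_right (x : V) : wedge K V x 0 = 0 := by
  simp [wedge]

lemma wedge_swap (x y : V) : wedge K V y x = -wedge K V x y := by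
  simp only [wedge]
  module

lemma vee_swap (x y : V) : vee K V y x = vee K V x y := by
  simp only [vee, add_comm]

end WedgeLemmas

lemma mk_wedge_swap {V : Type*} [AddCommGroup V] [Module K V] (x y : V) :
    (⟨wedge K V y x, wedge_mem K y x⟩ : lambda2 K V) = -⟨wedge K V x y, wedge_mem K x y⟩ :=
  Subtype.ext (wedge_swap K x y)

lemma kWedgeDer_le_lambda2 : kWedgeDer K k ≤ lambda2 K k := by
  refine Submodule.span_le.mpr ?_
  rintro _ ⟨x, y, -, rfl⟩
  exact wedge_mem K x y

lemma wedge_lie_mem_kWedgeDer (x y z : k) : wedge K k ⁅x, y⁆ z ∈ kWedgeDer K k := by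
  rw [wedge_swap]
  exact neg_mem (Submodule.subset_span ⟨z, ⁅x, y⁆, Submodule.subset_span ⟨x, y, rfl⟩, rfl⟩)

/-- `k ∧ k'` is spanned by the elements `x ∧ ⁅y, z⁆`. -/
lemma kWedgeDer_le_span :
    kWedgeDer K k ≤ Submodule.span K {t | ∃ x y z : k, t = wedge K k x ⁅y, z⁆} := by
  refine Submodule.span_le.mpr ?_
  rintro _ ⟨x, y, hy, rfl⟩
  change wedge K k x y ∈ Submodule.span K {t | ∃ x y z : k, t = wedge K k x ⁅y, z⁆}
  induction hy using Submodule.span_induction with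
  | mem y h =>
    obtain ⟨u, v, rfl⟩ := h
    exact Submodule.subset_span ⟨x, u, v, rfl⟩
  | zero => simp [wedge_zero_right]
  | add y y' _ _ h h' => rw [wedge_add_right]; exact add_mem h h'
  | smul c y _ h => rw [wedge_smul_right]; exact Submodule.smul_mem _ c h

section Boundaries

variable {K A k}

/-- A submodule contains all boundaries of the current algebra as soon as it contains those of
pure tensors. -/
lemma B2_le_of_tmul {S : Submodule K ((A ⊗[K] k) ⊗[K] (A ⊗[K] k))}
    (h : ∀ (a b c : A) (x y z : k), dd K (A ⊗[K] k) (a ⊗ₜ x) (b ⊗ₜ y) (c ⊗ₜ z) ∈ S) :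
    B2 K (A ⊗[K] k) ≤ S := by
  refine Submodule.span_le.mpr ?_
  rintro _ ⟨u, v, w, rfl⟩
  change dd K (A ⊗[K] k) u v w ∈ S
  induction u using TensorProduct.induction_on with
  | zero => simp [dd, wedge_zero_left, wedge_zero_right]
  | add u u' hu hu' =>
    convert add_mem hu hu' using 1
    simp only [dd, add_lie, lie_add, wedge_add_left, wedge_add_right]
    abel
  | tmul a x =>
    induction v using TensorProduct.induction_on with
    | zero => simp [dd, wedge_zero_left, wedge_zero_right]
    | add u u' hu hu' =>
      convert add_mem hu hu' using 1
      simp only [dd, add_lie, lie_add, wedge_add_left, wedge_add_right]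
      abel
    | tmul b y =>
      induction w using TensorProduct.induction_on with
      | zero => simp [dd, wedge_zero_left, wedge_zero_right]
      | add u u' hu hu' =>
        convert add_mem hu hu' using 1
        simp only [dd, add_lie, lie_add, wedge_add_left, wedge_add_right]
        abel
      | tmul c z => exact h a b c x y z

lemma dd_tmul (a b c : A) (x y z : k) :
    dd K (A ⊗[K] k) (a ⊗ₜ x) (b ⊗ₜ y) (c ⊗ₜ z) =
      wedge K (A ⊗[K] k) ((a * b) ⊗ₜ ⁅x, y⁆) (c ⊗ₜ z) +
      wedge K (A ⊗[K] k) ((b * c) ⊗ₜ ⁅y, z⁆) (a ⊗ₜ x) +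
      wedge K (A ⊗[K] k) ((c * a) ⊗ₜ ⁅z, x⁆) (b ⊗ₜ y) := rfl

/-- Twice the preimage under a decomposition `P` (see `IsDecomposition`) of
`(a ∨ b - ab ∨ 1) ⊗ (x ∧ ⁅y, z⁆)` is a boundary. -/
lemma wedge_lie_symm_mem_B2 (a b : A) (x y z : k) :
    wedge K (A ⊗[K] k) (a ⊗ₜ x) (b ⊗ₜ ⁅y, z⁆) + wedge K (A ⊗[K] k) (b ⊗ₜ x) (a ⊗ₜ ⁅y, z⁆)
      - (wedge K (A ⊗[K] k) ((a * b) ⊗ₜ x) (1 ⊗ₜ ⁅y, z⁆)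
        + wedge K (A ⊗[K] k) (1 ⊗ₜ x) ((a * b) ⊗ₜ ⁅y, z⁆)) ∈ B2 K (A ⊗[K] k) := by
  have d (p q r : A) := dd_mem_B2 K (L := A ⊗[K] k) (p ⊗ₜ x) (q ⊗ₜ y) (r ⊗ₜ z)
  convert sub_mem (d (a * b) 1 1) (Submodule.smul_mem _ (2⁻¹ : K)
    (sub_mem (add_mem (add_mem (d a b 1) (d b a 1)) (add_mem (d a 1 b) (d b 1 a)))
      (add_mem (d 1 a b) (d 1 b a)))) using 1
  simp only [dd_tmul, mul_one, one_mul, mul_comm b a,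
    wedge_swap K (_ ⊗ₜ[K] x) (_ ⊗ₜ[K] ⁅y, z⁆)]
  module

end Boundaries

section SymmetricKernel

variable {A}

/-- The linear map `a ⊗ b ↦ a ∨ b - ab ∨ 1`, which restricts to the identity on `I_A`. -/
noncomputable def toIa : A ⊗[K] A →ₗ[K] ia K A :=
  TensorProduct.lift (LinearMap.mk₂ K
    (fun a b => (⟨vee K A a b - vee K A (a * b) 1, ia_el_mem K a b⟩ : ia K A))
    (fun a a' b => Subtype.ext (by
      simp only [Submodule.coe_add, vee, add_mul, TensorProduct.add_tmul, TensorProduct.tmul_add]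
      module))
    (fun c a b => Subtype.ext (by
      simp only [Submodule.coe_smul, vee, smul_mul_assoc, ← TensorProduct.smul_tmul',
        TensorProduct.tmul_smul]
      module))
    (fun a b b' => Subtype.ext (by
      simp only [Submodule.coe_add, vee, mul_add, TensorProduct.add_tmul, TensorProduct.tmul_add]
      module))
    (fun c a b => Subtype.ext (by
      simp only [Submodule.coe_smul, vee, mul_smul_comm, ← TensorProduct.smul_tmul',
        TensorProduct.tmul_smul]
      module)))

lemma toIa_tmul (a b : A) :
    toIa K (a ⊗ₜ[K] b) = ⟨vee K A a b - vee K A (a * b) 1, ia_el_mem K a b⟩ := rfl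

lemma coe_toIa_of_mem_sym2 {t : A ⊗[K] A} (ht : t ∈ sym2 K A) :
    (toIa K t : A ⊗[K] A) = t - vee K A (LinearMap.mul' K A t) 1 := by
  induction ht using Submodule.span_induction with
  | mem t h =>
    obtain ⟨a, b, rfl⟩ := h
    rw [show toIa K (vee K A a b) =
      (2 : K)⁻¹ • (toIa K (a ⊗ₜ[K] b) + toIa K (b ⊗ₜ[K] a)) by simp [vee]]
    have hm : LinearMap.mul' K A (vee K A a b) = a * b := by
      simp only [vee, map_smul, map_add, LinearMap.mul'_apply, mul_comm b a]
      module
    rw [hm, toIa_tmul, toIa_tmul]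
    simp only [Submodule.coe_smul, Submodule.coe_add, vee_swap K a b, mul_comm b a]
    module
  | zero => simp [vee]
  | add t t' _ _ h h' =>
    simp only [map_add, Submodule.coe_add, h, h', vee, TensorProduct.add_tmul,
      TensorProduct.tmul_add]
    module
  | smul c t _ h =>
    simp only [map_smul, Submodule.coe_smul, h, vee, ← TensorProduct.smul_tmul',
      TensorProduct.tmul_smul]
    module

lemma toIa_coe (c : ia K A) : toIa K (c : A ⊗[K] A) = c := by
  obtain ⟨t, hs, hm⟩ := c
  refine Subtype.ext ((coe_toIa_of_mem_sym2 K hs).trans ?_)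
  rw [show LinearMap.mul' K A t = 0 from hm]
  simp [vee]

end SymmetricKernel

section ThirdComponent

variable {K A k}

/-- To contain `I_A ⊗ (k ∧ k')`, a submodule only has to contain the elements
`(a ∨ b - ab ∨ 1) ⊗ (x ∧ ⁅y, z⁆)`. -/
lemma sub3_le_of_forall {N : Submodule K (M3 K A k)}
    (h : ∀ (a b : A) (x y z : k),
      (⟨vee K A a b - vee K A (a * b) 1, ia_el_mem K a b⟩ : ia K A) ⊗ₜ[K]
        (⟨wedge K k x ⁅y, z⁆, wedge_mem K _ _⟩ : lambda2 K k) ∈ N) :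
    sub3 K A k ≤ N := by
  refine Submodule.span_le.mpr ?_
  rintro _ ⟨c, s, hs, rfl⟩
  change c ⊗ₜ[K] s ∈ N
  rw [← toIa_coe K c]
  induction (c : A ⊗[K] A) using TensorProduct.induction_on with
  | zero => simp
  | add e e' he he' => rw [map_add, TensorProduct.add_tmul]; exact add_mem he he'
  | tmul a b =>
    have hle : Submodule.span K {t | ∃ x y z : k, t = wedge K k x ⁅y, z⁆} ≤
        (N.comap (TensorProduct.mk K _ _ (toIa K (a ⊗ₜ[K] b)))).map (lambda2 K k).subtype := by
      refine Submodule.span_le.mpr ?_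
      rintro _ ⟨x, y, z, rfl⟩
      exact ⟨_, h a b x y z, rfl⟩
    obtain ⟨s', hs', hss⟩ := hle (kWedgeDer_le_span K k hs)
    rwa [Subtype.ext hss] at hs'

lemma symm_third_component {P : ↥(lambda2 K (A ⊗[K] k)) ≃ₗ[K] Wspace K A k}
    (hP : IsDecomposition K P) (a b : A) (x y : k) :
    ((P.symm (0, 0, (⟨vee K A a b - vee K A (a * b) 1, ia_el_mem K a b⟩ : ia K A) ⊗ₜ[K]
        (⟨wedge K k x y, wedge_mem K x y⟩ : lambda2 K k)) : ↥(lambda2 K (A ⊗[K] k))) :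
        (A ⊗[K] k) ⊗[K] (A ⊗[K] k)) =
      (2 : K)⁻¹ • (wedge K (A ⊗[K] k) (a ⊗ₜ x) (b ⊗ₜ y) + wedge K (A ⊗[K] k) (b ⊗ₜ x) (a ⊗ₜ y)
        - (wedge K (A ⊗[K] k) ((a * b) ⊗ₜ x) (1 ⊗ₜ y)
          + wedge K (A ⊗[K] k) (1 ⊗ₜ x) ((a * b) ⊗ₜ y))) := by
  let w (a b : A) : lambda2 K (A ⊗[K] k) :=
    ⟨wedge K (A ⊗[K] k) (a ⊗ₜ x) (b ⊗ₜ y), wedge_mem K _ _⟩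
  have hia (a b : A) : (⟨vee K A b a - vee K A (b * a) 1, ia_el_mem K b a⟩ : ia K A) =
      ⟨vee K A a b - vee K A (a * b) 1, ia_el_mem K a b⟩ :=
    Subtype.ext (by simp only [vee_swap K a b, mul_comm b a])
  have hone (a : A) : (⟨vee K A a 1 - vee K A (a * 1) 1, ia_el_mem K a 1⟩ : ia K A) = 0 :=
    Subtype.ext (by simp)
  have hw : P.symm (0, 0, (⟨vee K A a b - vee K A (a * b) 1, ia_el_mem K a b⟩ : ia K A) ⊗ₜ[K]
      (⟨wedge K k x y, wedge_mem K x y⟩ : lambda2 K k)) =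
      (2 : K)⁻¹ • (w a b + w b a - (w (a * b) 1 + w 1 (a * b))) := by
    rw [LinearEquiv.symm_apply_eq, map_smul, map_sub P, map_add, map_add]
    simp only [w]
    rw [hP, hP, hP, hP, hia a b, hia (a * b) 1, hone, mk_wedge_swap K a b,
      mk_wedge_swap K (a * b) 1]
    refine Prod.ext ?_ (Prod.ext ?_ ?_)
    · simp only [Prod.smul_fst, Prod.fst_sub, Prod.fst_add, TensorProduct.neg_tmul]
      module
    · simp [mul_comm b a]
    · simp only [Prod.smul_snd, Prod.snd_sub, Prod.snd_add, TensorProduct.zero_tmul]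
      module
  rw [hw]
  rfl

lemma symm_mem_B2_of_mem_sub3 {P : ↥(lambda2 K (A ⊗[K] k)) ≃ₗ[K] Wspace K A k}
    (hP : IsDecomposition K P) {t : M3 K A k} (ht : t ∈ sub3 K A k) :
    ((P.symm (0, 0, t) : ↥(lambda2 K (A ⊗[K] k))) : (A ⊗[K] k) ⊗[K] (A ⊗[K] k)) ∈
      B2 K (A ⊗[K] k) := by
  let f : M3 K A k →ₗ[K] (A ⊗[K] k) ⊗[K] (A ⊗[K] k) :=
    (lambda2 K (A ⊗[K] k)).subtype ∘ₗ P.symm.toLinearMap ∘ₗ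
      LinearMap.inr K (M1 K A k) (M2 K A k × M3 K A k) ∘ₗ LinearMap.inr K (M2 K A k) (M3 K A k)
  have hle : sub3 K A k ≤ (B2 K (A ⊗[K] k)).comap f := by
    refine sub3_le_of_forall fun a b x y z => ?_
    rw [Submodule.mem_comap]
    exact Set.mem_of_eq_of_mem (symm_third_component hP a b x ⁅y, z⁆)
      (Submodule.smul_mem _ _ (wedge_lie_symm_mem_B2 a b x y z))
  exact hle ht

/-- The third component `p₃` of `P` maps boundaries into `I_A ⊗ (k ∧ k')`. -/
lemma third_component_mem_sub3 {P : ↥(lambda2 K (A ⊗[K] k)) ≃ₗ[K] Wspace K A k}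
    (hP : IsDecomposition K P) {t : lambda2 K (A ⊗[K] k)}
    (ht : (t : (A ⊗[K] k) ⊗[K] (A ⊗[K] k)) ∈ B2 K (A ⊗[K] k)) :
    (P t).2.2 ∈ sub3 K A k := by
  let p₃ : lambda2 K (A ⊗[K] k) →ₗ[K] M3 K A k :=
    LinearMap.snd K (M2 K A k) (M3 K A k) ∘ₗ
      LinearMap.snd K (M1 K A k) (M2 K A k × M3 K A k) ∘ₗ P.toLinearMap
  have hwedge (p q : A) (x y z : k) : p₃ ⟨wedge K (A ⊗[K] k) (p ⊗ₜ ⁅x, y⁆) (q ⊗ₜ z),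
      wedge_mem K _ _⟩ ∈ sub3 K A k := by
    change (P _).2.2 ∈ _
    rw [hP]
    exact Submodule.subset_span ⟨_, _, wedge_lie_mem_kWedgeDer K k x y z, rfl⟩
  have hle : B2 K (A ⊗[K] k) ≤ ((sub3 K A k).comap p₃).map (lambda2 K (A ⊗[K] k)).subtype := by
    refine B2_le_of_tmul fun a b c x y z => ?_
    rw [dd_tmul]
    exact add_mem (add_mem ⟨_, hwedge _ _ x y z, rfl⟩ ⟨_, hwedge _ _ y z x, rfl⟩)
      ⟨_, hwedge _ _ z x y, rfl⟩
  obtain ⟨t', ht', htt⟩ := hle ht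
  rwa [Subtype.ext htt] at ht'

end ThirdComponent

/-- `p₃(B₂(g)) = I_A ⊗ (k ∧ k')` and `P⁻¹(I_A ⊗ (k ∧ k')) ⊆ B₂(g)`. -/
theorem statement5
    (P : ↥(lambda2 K (A ⊗[K] k)) ≃ₗ[K] Wspace K A k) (hP : IsDecomposition K P) :
    Submodule.map ((LinearMap.snd K (M2 K A k) (M3 K A k)).comp
        ((LinearMap.snd K (M1 K A k) (M2 K A k × M3 K A k)).comp P.toLinearMap))
        ((B2 K (A ⊗[K] k)).comap (lambda2 K (A ⊗[K] k)).subtype) =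
      sub3 K A k ∧
    ∀ t : M3 K A k, t ∈ sub3 K A k →
      ((P.symm (0, 0, t) : ↥(lambda2 K (A ⊗[K] k))) : (A ⊗[K] k) ⊗[K] (A ⊗[K] k)) ∈
        B2 K (A ⊗[K] k) := by
  refine ⟨le_antisymm ?_ fun t ht => ?_, fun t ht => symm_mem_B2_of_mem_sub3 hP ht⟩
  · rintro _ ⟨t, ht, rfl⟩
    exact third_component_mem_sub3 hP ht
  · exact ⟨P.symm (0, 0, t), symm_mem_B2_of_mem_sub3 hP ht, by simp⟩

end CurrentPaper
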